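/- Let K = ℤ be the tropical semifield and n ∈ ℕ. Then 𝒰_ℕ^n, the set of equivalence classes A contained in ℐ×ℕ^ν with a_1 ≤ n for every (i,a) ∈ A, is a finite set. -/

import Mathlib

open scoped BigOperators

namespace Lusztig

variable {I : Type*} [Fintype I] [DecidableEq I]

/-- A simply laced Cartan matrix: symmetric, positive definite, integer entries,
`2` on the diagonal and `0` or `-1` off the diagonal. -/
structure IsSimplyLacedCartan (A : Matrix I I ℤ) : Prop where
  symm : ∀ i j, A i j = A j i
  posDef : ∀ x : I → ℤ, x ≠ 0 → 0 < ∑ i, ∑ j, x i * A i j * x j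
  diag : ∀ i, A i i = 2
  offDiag : ∀ i j, i ≠ j → A i j = 0 ∨ A i j = -1

/-- The simple reflection `s_i` acting on `ℤ[I] = I → ℤ`, `s_i(j') = j' - a_{ij} i'`. -/
def sE (A : Matrix I I ℤ) (i : I) : Function.End (I → ℤ) :=
  fun x => x - (∑ j, A i j * x j) • Pi.single i 1

/-- The length of `w`: the least `n` such that `w` is a product of `n` simple
reflections (`∞` convention: `sInf ∅ = 0`). -/
noncomputable def len (A : Matrix I I ℤ) (w : Function.End (I → ℤ)) : ℕ :=
  sInf {n | ∃ l : List I, l.length = n ∧ (l.map (sE A)).prod = w}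

/-- `w₀` is the longest element of `W = ⟨s_i⟩` and `ν = |w₀|`. -/
structure IsLongest (A : Matrix I I ℤ) (w₀ : Function.End (I → ℤ)) (ν : ℕ) : Prop where
  mem : ∃ l : List I, (l.map (sE A)).prod = w₀
  len_eq : len A w₀ = ν
  longest : ∀ w : Function.End (I → ℤ),
    (∃ l : List I, (l.map (sE A)).prod = w) → len A w ≤ ν

/-- `ℐ`: the set of sequences `(i_1, …, i_ν)` with `s_{i_1} ⋯ s_{i_ν} = w₀`. -/
def RedWord (A : Matrix I I ℤ) (w₀ : Function.End (I → ℤ)) (ν : ℕ) :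
    Set (Fin ν → I) :=
  {f | ((List.ofFn f).map (sE A)).prod = w₀}

/-- The coefficient `r_{h,k}` defined by
`s_{i_1} ⋯ s_{i_{k-1}} (i_k') = Σ_h r_{h,k} h'` (here `k` is `0`-indexed). -/
def rCoef (A : Matrix I I ℤ) {ν : ℕ} (f : Fin ν → I) (h : I) (k : Fin ν) : ℤ :=
  ((List.ofFn fun m : Fin (k : ℕ) => sE A (f (Fin.castLE k.2.le m))).prod :
    Function.End (I → ℤ)) (Pi.single (f k) 1) h

/-- `‖i,a‖_h = Π_k a_k^{r_{h,k}}`. -/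
def normAt (A : Matrix I I ℤ) {ν : ℕ} {K : Type*} [CommGroup K]
    (f : Fin ν → I) (a : Fin ν → K) (h : I) : K :=
  ∏ k : Fin ν, a k ^ rCoef A f h k

section Semifield

variable {K : Type*} [CommGroup K] [AddCommSemigroup K]

/-- Adjacency of two pairs in `ℐ × K^ν`, for a semifield `K` (written
multiplicatively, with addition `+`). -/
def Adjacent (A : Matrix I I ℤ) (w₀ : Function.End (I → ℤ)) (ν : ℕ)
    (p q : (Fin ν → I) × (Fin ν → K)) : Prop :=
  p.1 ∈ RedWord A w₀ ν ∧ q.1 ∈ RedWord A w₀ ν ∧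
  ((∃ (l : ℕ) (h0 : l < ν) (h1 : l + 1 < ν) (h2 : l + 2 < ν),
      A (p.1 ⟨l, h0⟩) (p.1 ⟨l + 1, h1⟩) = -1 ∧
      p.1 ⟨l + 2, h2⟩ = p.1 ⟨l, h0⟩ ∧
      q.1 ⟨l, h0⟩ = p.1 ⟨l + 1, h1⟩ ∧ q.1 ⟨l + 1, h1⟩ = p.1 ⟨l, h0⟩ ∧
      q.1 ⟨l + 2, h2⟩ = p.1 ⟨l + 1, h1⟩ ∧
      (∀ k : Fin ν, (k : ℕ) ≠ l → (k : ℕ) ≠ l + 1 → (k : ℕ) ≠ l + 2 →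
        q.1 k = p.1 k ∧ q.2 k = p.2 k) ∧
      q.2 ⟨l, h0⟩ =
        p.2 ⟨l + 1, h1⟩ * p.2 ⟨l + 2, h2⟩ * (p.2 ⟨l, h0⟩ + p.2 ⟨l + 2, h2⟩)⁻¹ ∧
      q.2 ⟨l + 1, h1⟩ = p.2 ⟨l, h0⟩ + p.2 ⟨l + 2, h2⟩ ∧
      q.2 ⟨l + 2, h2⟩ =
        p.2 ⟨l, h0⟩ * p.2 ⟨l + 1, h1⟩ * (p.2 ⟨l, h0⟩ + p.2 ⟨l + 2, h2⟩)⁻¹) ∨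
   (∃ (l : ℕ) (h0 : l < ν) (h1 : l + 1 < ν),
      A (p.1 ⟨l, h0⟩) (p.1 ⟨l + 1, h1⟩) = 0 ∧
      q.1 ⟨l, h0⟩ = p.1 ⟨l + 1, h1⟩ ∧ q.1 ⟨l + 1, h1⟩ = p.1 ⟨l, h0⟩ ∧
      (∀ k : Fin ν, (k : ℕ) ≠ l → (k : ℕ) ≠ l + 1 →
        q.1 k = p.1 k ∧ q.2 k = p.2 k) ∧
      q.2 ⟨l, h0⟩ = p.2 ⟨l + 1, h1⟩ ∧ q.2 ⟨l + 1, h1⟩ = p.2 ⟨l, h0⟩))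

end Semifield

/-- Adjacency of two pairs in `ℐ × ℤ^ν` for the tropical semifield `ℤ`
(sum = `min`, product = `+`). -/
def TAdjacent (A : Matrix I I ℤ) (w₀ : Function.End (I → ℤ)) (ν : ℕ)
    (p q : (Fin ν → I) × (Fin ν → ℤ)) : Prop :=
  p.1 ∈ RedWord A w₀ ν ∧ q.1 ∈ RedWord A w₀ ν ∧
  ((∃ (l : ℕ) (h0 : l < ν) (h1 : l + 1 < ν) (h2 : l + 2 < ν),
      A (p.1 ⟨l, h0⟩) (p.1 ⟨l + 1, h1⟩) = -1 ∧
      p.1 ⟨l + 2, h2⟩ = p.1 ⟨l, h0⟩ ∧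
      q.1 ⟨l, h0⟩ = p.1 ⟨l + 1, h1⟩ ∧ q.1 ⟨l + 1, h1⟩ = p.1 ⟨l, h0⟩ ∧
      q.1 ⟨l + 2, h2⟩ = p.1 ⟨l + 1, h1⟩ ∧
      (∀ k : Fin ν, (k : ℕ) ≠ l → (k : ℕ) ≠ l + 1 → (k : ℕ) ≠ l + 2 →
        q.1 k = p.1 k ∧ q.2 k = p.2 k) ∧
      q.2 ⟨l, h0⟩ =
        p.2 ⟨l + 1, h1⟩ + p.2 ⟨l + 2, h2⟩ - min (p.2 ⟨l, h0⟩) (p.2 ⟨l + 2, h2⟩) ∧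
      q.2 ⟨l + 1, h1⟩ = min (p.2 ⟨l, h0⟩) (p.2 ⟨l + 2, h2⟩) ∧
      q.2 ⟨l + 2, h2⟩ =
        p.2 ⟨l, h0⟩ + p.2 ⟨l + 1, h1⟩ - min (p.2 ⟨l, h0⟩) (p.2 ⟨l + 2, h2⟩)) ∨
   (∃ (l : ℕ) (h0 : l < ν) (h1 : l + 1 < ν),
      A (p.1 ⟨l, h0⟩) (p.1 ⟨l + 1, h1⟩) = 0 ∧
      q.1 ⟨l, h0⟩ = p.1 ⟨l + 1, h1⟩ ∧ q.1 ⟨l + 1, h1⟩ = p.1 ⟨l, h0⟩ ∧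
      (∀ k : Fin ν, (k : ℕ) ≠ l → (k : ℕ) ≠ l + 1 →
        q.1 k = p.1 k ∧ q.2 k = p.2 k) ∧
      q.2 ⟨l, h0⟩ = p.2 ⟨l + 1, h1⟩ ∧ q.2 ⟨l + 1, h1⟩ = p.2 ⟨l, h0⟩))

/-- The element `s_{i_1} ⋯ s_{i_m}` of `W` attached to a word. -/
def wordProd (A : Matrix I I ℤ) (l : List I) : Function.End (I → ℤ) :=
  (l.map (sE A)).prod

/-- `i` is a right descent of the element of `W` attached to the word `l`. -/
def IsDescent (A : Matrix I I ℤ) (l : List I) (i : I) : Prop :=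
  len A (wordProd A (l ++ [i])) < len A (wordProd A l)

/-- A word is reduced when its length is the length of its product. -/
def IsReduced (A : Matrix I I ℤ) (l : List I) : Prop := len A (wordProd A l) = l.length

section Words

variable {A : Matrix I I ℤ}

lemma sE_apply (i : I) (x : I → ℤ) :
    sE A i x = x - (∑ j, A i j * x j) • Pi.single i 1 := rfl

lemma wordProd_nil (x : I → ℤ) : wordProd A [] x = x := rfl

lemma wordProd_cons (i : I) (l : List I) (x : I → ℤ) :
    wordProd A (i :: l) x = sE A i (wordProd A l x) := by
  simp only [wordProd, List.map_cons, List.prod_cons]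
  rfl

lemma wordProd_append (l m : List I) (x : I → ℤ) :
    wordProd A (l ++ m) x = wordProd A l (wordProd A m x) := by
  simp only [wordProd, List.map_append, List.prod_append]
  rfl

lemma wordProd_append_congr {l l' m m' : List I} (h : wordProd A l = wordProd A l')
    (h' : wordProd A m = wordProd A m') : wordProd A (l ++ m) = wordProd A (l' ++ m') := by
  funext x
  rw [wordProd_append, wordProd_append, h, h']

lemma sE_add (i : I) (x y : I → ℤ) : sE A i (x + y) = sE A i x + sE A i y := by
  simp only [sE_apply, Pi.add_apply, mul_add, Finset.sum_add_distrib, add_smul]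
  abel

lemma sE_smul (i : I) (c : ℤ) (x : I → ℤ) : sE A i (c • x) = c • sE A i x := by
  simp only [sE_apply, Pi.smul_apply, smul_eq_mul, smul_sub, smul_smul, Finset.mul_sum]
  congr 3
  funext j
  ring

lemma wordProd_add (l : List I) (x y : I → ℤ) :
    wordProd A l (x + y) = wordProd A l x + wordProd A l y := by
  induction l with
  | nil => rfl
  | cons i l ih => simp only [wordProd_cons, ih, sE_add]

lemma wordProd_smul (l : List I) (c : ℤ) (x : I → ℤ) :
    wordProd A l (c • x) = c • wordProd A l x := by
  induction l with
  | nil => rfl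
  | cons i l ih => simp only [wordProd_cons, ih, sE_smul]

lemma wordProd_neg (l : List I) (x : I → ℤ) : wordProd A l (-x) = -wordProd A l x := by
  simpa using wordProd_smul (A := A) l (-1) x

lemma wordProd_zero (l : List I) : wordProd A l 0 = 0 := by
  simpa using wordProd_smul (A := A) l 0 0

lemma wordProd_sum (l : List I) (x : I → ℤ) :
    wordProd A l x = ∑ j, x j • wordProd A l (Pi.single j 1) := by
  let f : (I → ℤ) →ₗ[ℤ] (I → ℤ) :=
    { toFun := wordProd A l
      map_add' := wordProd_add l
      map_smul' := wordProd_smul l }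
  have h : f x = ∑ j, x j • f (Pi.single j 1) := by
    conv_lhs => rw [pi_eq_sum_univ' x]
    simp only [map_sum, map_smul]
  exact h

lemma wordProd_nonpos {l : List I} (h : ∀ j, wordProd A l (Pi.single j 1) ≤ 0) {x : I → ℤ}
    (hx : 0 ≤ x) : wordProd A l x ≤ 0 := by
  rw [wordProd_sum]
  exact Finset.sum_nonpos fun j _ => smul_nonpos_of_nonneg_of_nonpos (hx j) (h j)

lemma sE_single (i j : I) :
    sE A i (Pi.single j 1) = Pi.single j 1 - A i j • Pi.single i 1 := by
  simp [sE_apply, Pi.single_apply]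

variable (hA : IsSimplyLacedCartan A)
include hA

lemma sE_single_self (i : I) : sE A i (Pi.single i 1) = -Pi.single i 1 := by
  rw [sE_single, hA.diag, two_smul]
  abel

lemma sE_sE (i : I) (x : I → ℤ) : sE A i (sE A i x) = x := by
  conv_lhs => rw [sE_apply i x, sub_eq_add_neg, sE_add, ← neg_smul, sE_smul,
    sE_single_self hA, sE_apply]
  simp

lemma sE_comm {i j : I} (hij : A i j = 0) (x : I → ℤ) :
    sE A i (sE A j x) = sE A j (sE A i x) := by
  have hji : A j i = 0 := by rw [hA.symm, hij]
  rw [sE_apply j x, sE_apply i x]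
  simp only [sub_eq_add_neg, ← neg_smul, sE_add, sE_smul, sE_single, hij, hji]
  rw [sE_apply i x, sE_apply j x]
  simp only [sub_eq_add_neg, ← neg_smul]
  module

lemma sE_braid {i j : I} (hij : A i j = -1) (x : I → ℤ) :
    sE A i (sE A j (sE A i x)) = sE A j (sE A i (sE A j x)) := by
  have hji : A j i = -1 := by rw [hA.symm, hij]
  simp only [sE_apply _ x, sub_eq_add_neg, ← neg_smul, sE_add, sE_smul, sE_single, hij, hji,
    hA.diag]
  module

lemma wordProd_comm {i j : I} (hij : A i j = 0) : wordProd A [i, j] = wordProd A [j, i] := by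
  funext x
  simp only [wordProd_cons, wordProd_nil, sE_comm hA hij]

lemma wordProd_braid {i j : I} (hij : A i j = -1) :
    wordProd A [i, j, i] = wordProd A [j, i, j] := by
  funext x
  simp only [wordProd_cons, wordProd_nil, sE_braid hA hij]

lemma wordProd_append_twice (l : List I) (i : I) :
    wordProd A (l ++ [i] ++ [i]) = wordProd A l := by
  funext x
  simp only [wordProd_append, wordProd_cons, wordProd_nil, sE_sE hA]

lemma wordProd_reverse (l : List I) (x : I → ℤ) :
    wordProd A l (wordProd A l.reverse x) = x := by
  induction l generalizing x with
  | nil => rfl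
  | cons i l ih =>
    rw [List.reverse_cons, wordProd_append, wordProd_cons, ih, wordProd_cons, wordProd_nil,
      sE_sE hA]

lemma wordProd_reverse' (l : List I) (x : I → ℤ) :
    wordProd A l.reverse (wordProd A l x) = x := by
  simpa using wordProd_reverse hA l.reverse x

lemma wordProd_reverse_congr {l l' : List I} (h : wordProd A l = wordProd A l') :
    wordProd A l.reverse = wordProd A l'.reverse := by
  funext x
  rw [← wordProd_reverse' hA l (wordProd A l'.reverse x), h, wordProd_reverse hA]

omit hA in
lemma len_wordProd_le (l : List I) : len A (wordProd A l) ≤ l.length :=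
  Nat.sInf_le ⟨l, rfl, rfl⟩

omit hA in
lemma exists_reduced (A : Matrix I I ℤ) (l : List I) :
    ∃ l', wordProd A l' = wordProd A l ∧ l'.length = len A (wordProd A l) := by
  obtain ⟨l', h, h'⟩ := Nat.sInf_mem
    (s := {n | ∃ m : List I, m.length = n ∧ (m.map (sE A)).prod = wordProd A l})
    ⟨_, l, rfl, rfl⟩
  exact ⟨l', h', h⟩

omit hA in
lemma len_append_le (l m : List I) :
    len A (wordProd A (l ++ m)) ≤ len A (wordProd A l) + m.length := by
  obtain ⟨l', h, h'⟩ := exists_reduced A l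
  rw [← wordProd_append_congr h (rfl : wordProd A m = _), ← h', ← List.length_append]
  exact len_wordProd_le _

lemma len_le_append (l : List I) (i : I) :
    len A (wordProd A l) ≤ len A (wordProd A (l ++ [i])) + 1 := by
  have := len_append_le (A := A) (l ++ [i]) [i]
  rwa [wordProd_append_twice hA] at this

lemma IsDescent.len_add_one {l : List I} {i : I} (h : IsDescent A l i) :
    len A (wordProd A (l ++ [i])) + 1 = len A (wordProd A l) := by
  have := len_le_append hA l i
  unfold IsDescent at h
  omega

lemma wordProd_single_nonneg {l : List I} {i : I} (h : ¬ IsDescent A l i) :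
    0 ≤ wordProd A l (Pi.single i 1) := by
  obtain ⟨n, hn⟩ : ∃ n, len A (wordProd A l) = n := ⟨_, rfl⟩
  induction n using Nat.strong_induction_on generalizing l i with
  | _ n ih =>
    unfold IsDescent at h ih
    push Not at h ih
    obtain ⟨l', hl', hlen⟩ := exists_reduced A l
    have hi : wordProd A (l' ++ [i]) = wordProd A (l ++ [i]) := wordProd_append_congr hl' rfl
    rw [← hl', ← hi] at h
    rw [← hl'] at hn hlen ⊢
    rcases List.eq_nil_or_concat l' with rfl | ⟨u, j, hu⟩
    · rw [wordProd_nil]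
      intro k
      by_cases hk : k = i <;> simp [hk]
    rw [List.concat_eq_append] at hu
    subst hu
    simp only [List.length_append, List.length_singleton] at hlen
    have hu1 := len_wordProd_le (A := A) u
    have hu2 := len_append_le (A := A) u [j]
    simp only [List.length_singleton] at hu2
    have hij : i ≠ j := by
      rintro rfl
      rw [wordProd_append_twice hA] at h
      omega
    have huj : 0 ≤ wordProd A u (Pi.single j 1) := ih _ (by omega) (by omega) rfl
    rw [wordProd_append, wordProd_cons, wordProd_nil, sE_single]
    rcases hA.offDiag j i hij.symm with h0 | h1
    · rw [h0, zero_smul, sub_zero]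
      refine ih _ (by omega) ?_ rfl
      by_contra! hcon
      have e : wordProd A (u ++ [j] ++ [i]) = wordProd A (u ++ [i] ++ [j]) := by
        simpa using wordProd_append_congr (rfl : wordProd A u = _) (wordProd_comm hA h0)
      have := len_append_le (A := A) (u ++ [i]) [j]
      rw [e] at h
      simp only [List.length_singleton] at this
      omega
    · rw [h1, neg_smul, one_smul, sub_neg_eq_add, wordProd_add]
      by_cases hui : len A (wordProd A u) ≤ len A (wordProd A (u ++ [i]))
      · exact add_nonneg (ih _ (by omega) hui rfl) huj
      · have hv : wordProd A u (Pi.single i 1) + wordProd A u (Pi.single j 1) =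
            wordProd A (u ++ [i]) (Pi.single j 1) := by
          rw [wordProd_append, wordProd_cons, wordProd_nil, sE_single, hA.symm, h1,
            neg_smul, one_smul, sub_neg_eq_add, wordProd_add, add_comm]
        rw [hv]
        refine ih _ (by omega) ?_ rfl
        by_contra! hcon
        have e : wordProd A (u ++ [j] ++ [i]) = wordProd A (u ++ [i] ++ [j] ++ [i, j]) := by
          have h2 : wordProd A (u ++ [j, i, j] ++ [j]) = wordProd A (u ++ [i, j, i] ++ [j]) :=
            wordProd_append_congr
              (wordProd_append_congr rfl (wordProd_braid hA h1)) rfl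
          have h3 := wordProd_append_twice hA (u ++ [j] ++ [i]) j
          simp only [List.append_assoc, List.cons_append, List.nil_append] at h2 h3 ⊢
          rw [← h3, h2]
        have := len_append_le (A := A) (u ++ [i] ++ [j]) [i, j]
        rw [e] at h
        simp only [List.length_cons, List.length_nil] at this
        omega

lemma wordProd_single_nonpos {l : List I} {i : I} (h : IsDescent A l i) :
    wordProd A l (Pi.single i 1) ≤ 0 := by
  have h1 : ¬ IsDescent A (l ++ [i]) i := by
    unfold IsDescent at h ⊢
    rw [wordProd_append_twice hA]
    omega
  have h2 := wordProd_single_nonneg hA h1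
  rw [wordProd_append, wordProd_cons, wordProd_nil, sE_single_self hA, wordProd_neg] at h2
  simpa using h2

lemma wordProd_single_ne_zero (l : List I) (i : I) : wordProd A l (Pi.single i 1) ≠ 0 := by
  intro h
  have h1 := wordProd_reverse' hA l (Pi.single i 1)
  rw [h, wordProd_zero] at h1
  simpa using congrFun h1 i

lemma isDescent_iff {l : List I} {i : I} :
    IsDescent A l i ↔ wordProd A l (Pi.single i 1) ≤ 0 := by
  refine ⟨wordProd_single_nonpos hA, fun h => ?_⟩
  by_contra hd
  exact wordProd_single_ne_zero hA l i (le_antisymm h (wordProd_single_nonneg hA hd))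

lemma exists_reduced_of_isDescent {l : List I} {i : I} (h : IsDescent A l i) :
    ∃ u, wordProd A (u ++ [i]) = wordProd A l ∧ u.length + 1 = len A (wordProd A l) := by
  obtain ⟨u, hu, hlen⟩ := exists_reduced A (l ++ [i])
  refine ⟨u, ?_, ?_⟩
  · rw [wordProd_append_congr hu (rfl : wordProd A [i] = _), wordProd_append_twice hA]
  · rw [hlen, h.len_add_one hA]

/-- Two commuting descents can be split off simultaneously. -/
lemma exists_reduced_of_comm {l : List I} {i j : I} (hij : A i j = 0)
    (hi : IsDescent A l i) (hj : IsDescent A l j) :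
    ∃ u, wordProd A (u ++ [i, j]) = wordProd A l ∧ u.length + 2 = len A (wordProd A l) := by
  have h1 : IsDescent A (l ++ [j]) i := by
    rw [isDescent_iff hA] at hi ⊢
    rwa [wordProd_append, wordProd_cons, wordProd_nil, sE_single, hA.symm, hij, zero_smul,
      sub_zero]
  obtain ⟨u, hu, hlen⟩ := exists_reduced_of_isDescent hA h1
  refine ⟨u, ?_, ?_⟩
  · have h2 := wordProd_append_congr hu (rfl : wordProd A [j] = _)
    rw [wordProd_append_twice hA] at h2
    simpa using h2
  · have := hj.len_add_one hA
    omega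

/-- Two non-commuting descents can be split off simultaneously. -/
lemma exists_reduced_of_braid {l : List I} {i j : I} (hij : A i j = -1)
    (hi : IsDescent A l i) (hj : IsDescent A l j) :
    ∃ u, wordProd A (u ++ [j, i, j]) = wordProd A l ∧
      u.length + 3 = len A (wordProd A l) := by
  have hji : A j i = -1 := by rw [hA.symm, hij]
  have h1 : IsDescent A (l ++ [j]) i := by
    rw [isDescent_iff hA] at hi hj ⊢
    rw [wordProd_append, wordProd_cons, wordProd_nil, sE_single, hji, neg_smul, one_smul,
      sub_neg_eq_add, wordProd_add]
    exact add_nonpos hi hj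
  have h2 : IsDescent A (l ++ [j] ++ [i]) j := by
    rw [isDescent_iff hA] at hi hj ⊢
    have e : wordProd A (l ++ [j] ++ [i]) (Pi.single j 1) = wordProd A l (Pi.single i 1) := by
      simp only [wordProd_append, wordProd_cons, wordProd_nil, sE_single, hij, neg_smul,
        one_smul, sub_neg_eq_add, sE_add, hji, sE_single_self hA]
      congr 1
      abel
    rwa [e]
  obtain ⟨u, hu, hlen⟩ := exists_reduced_of_isDescent hA h2
  refine ⟨u, ?_, ?_⟩
  · have h3 := wordProd_append_congr hu (rfl : wordProd A [i, j] = _)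
    have h4 := wordProd_append_congr (wordProd_append_twice hA (l ++ [j]) i)
      (rfl : wordProd A [j] = _)
    rw [wordProd_append_twice hA] at h4
    simp only [List.append_assoc, List.cons_append, List.nil_append] at h3 h4 ⊢
    rw [h3, h4]
  · have := hj.len_add_one hA
    have := h1.len_add_one hA
    omega

omit hA in
lemma IsReduced.left {l m : List I} (h : IsReduced A (l ++ m)) : IsReduced A l := by
  have h1 := len_append_le (A := A) l m
  have h2 := len_wordProd_le (A := A) l
  simp only [IsReduced, List.length_append] at h ⊢
  omega

omit hA in
lemma IsReduced.of_eq {l m : List I} (h : IsReduced A l) (he : wordProd A m = wordProd A l)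
    (hl : m.length = l.length) : IsReduced A m := by
  rw [IsReduced, he, h, hl]

lemma len_reverse_le (l : List I) :
    len A (wordProd A l.reverse) ≤ len A (wordProd A l) := by
  obtain ⟨m, hm, hlen⟩ := exists_reduced A l
  rw [← hlen, ← wordProd_reverse_congr hA hm, ← List.length_reverse]
  exact len_wordProd_le _

lemma len_reverse (l : List I) : len A (wordProd A l.reverse) = len A (wordProd A l) :=
  le_antisymm (len_reverse_le hA l) (by simpa using len_reverse_le hA l.reverse)

lemma IsReduced.reverse {l : List I} (h : IsReduced A l) : IsReduced A l.reverse := by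
  rw [IsReduced, len_reverse hA, h, List.length_reverse]

lemma IsReduced.right {l m : List I} (h : IsReduced A (l ++ m)) : IsReduced A m := by
  have h1 := h.reverse hA
  rw [List.reverse_append] at h1
  simpa using h1.left.reverse hA

lemma wordProd_right_cancel {l l' : List I} {i : I}
    (h : wordProd A (l ++ [i]) = wordProd A (l' ++ [i])) : wordProd A l = wordProd A l' := by
  rw [← wordProd_append_twice hA l i, ← wordProd_append_twice hA l' i]
  exact wordProd_append_congr h rfl

lemma IsReduced.isDescent {l : List I} {i : I} (h : IsReduced A (l ++ [i])) :
    IsDescent A (l ++ [i]) i := by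
  have h1 := h.left
  simp only [IsReduced, List.length_append, List.length_singleton] at h h1
  rw [IsDescent, wordProd_append_twice hA, h, h1]
  omega

omit hA in
lemma IsReduced.not_isDescent {l : List I} {i : I} (h : IsReduced A (l ++ [i])) :
    ¬ IsDescent A l i := by
  have h1 := h.left
  simp only [IsReduced, List.length_append, List.length_singleton] at h h1
  rw [IsDescent, h, h1]
  omega

/-- If `l ++ m` is a word for the longest element and `i` is not a right descent of `l`, then
`m` can be replaced by a word starting with `i`. -/
lemma exists_reduced_cons {l m : List I} {i : I} (h : IsReduced A (l ++ m))
    (hmax : ∀ j, IsDescent A (l ++ m) j) (hi : ¬ IsDescent A l i) :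
    ∃ m', wordProd A (i :: m') = wordProd A m ∧ m'.length + 1 = m.length := by
  have hinv : ∀ j, wordProd A (l ++ m).reverse (Pi.single j 1) ≤ 0 := by
    intro j
    by_contra hcon
    have h1 : 0 ≤ wordProd A (l ++ m).reverse (Pi.single j 1) := by
      refine wordProd_single_nonneg hA ?_
      rwa [isDescent_iff hA]
    have h2 := wordProd_nonpos (fun k => (isDescent_iff hA).1 (hmax k)) h1
    rw [wordProd_reverse hA] at h2
    simpa using h2 j
  have hm : IsDescent A m.reverse i := by
    rw [isDescent_iff hA]
    have h1 := wordProd_nonpos hinv (wordProd_single_nonneg hA hi)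
    rwa [List.reverse_append, wordProd_append, wordProd_reverse' hA] at h1
  obtain ⟨u, hu, hlen⟩ := exists_reduced_of_isDescent hA hm
  refine ⟨u.reverse, ?_, ?_⟩
  · simpa using wordProd_reverse_congr hA hu
  · rw [len_reverse hA, h.right hA] at hlen
    simpa using hlen

end Words

/-- One step of the adjacency relation on words with integer labels. -/
inductive Move (A : Matrix I I ℤ) : List (I × ℤ) → List (I × ℤ) → Prop
  | braid (s t : List (I × ℤ)) {i j : I} (a b c : ℤ) (hij : A i j = -1) :
      Move A (s ++ (i, a) :: (j, b) :: (i, c) :: t)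
        (s ++ (j, b + c - min a c) :: (i, min a c) :: (j, a + b - min a c) :: t)
  | comm (s t : List (I × ℤ)) {i j : I} (a b : ℤ) (hij : A i j = 0) :
      Move A (s ++ (i, a) :: (j, b) :: t) (s ++ (j, b) :: (i, a) :: t)

section Moves

open Relation

variable {A : Matrix I I ℤ}

omit [Fintype I] [DecidableEq I] in
lemma Move.context (s t : List (I × ℤ)) {d d' : List (I × ℤ)} (h : Move A d d') :
    Move A (s ++ d ++ t) (s ++ d' ++ t) := by
  cases h with
  | braid u v a b c hij => simpa using Move.braid (s ++ u) (v ++ t) a b c hij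
  | comm u v a b hij => simpa using Move.comm (s ++ u) (v ++ t) a b hij

omit [Fintype I] [DecidableEq I] in
lemma moves_context (s t : List (I × ℤ)) {d d' : List (I × ℤ)}
    (h : ReflTransGen (Move A) d d') :
    ReflTransGen (Move A) (s ++ d ++ t) (s ++ d' ++ t) :=
  h.lift (fun d => s ++ d ++ t) fun _ _ => Move.context s t

omit [Fintype I] [DecidableEq I] in
lemma moves_append_right (t : List (I × ℤ)) {d d' : List (I × ℤ)}
    (h : ReflTransGen (Move A) d d') : ReflTransGen (Move A) (d ++ t) (d' ++ t) := by
  simpa using moves_context [] t h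

omit [Fintype I] [DecidableEq I] in
lemma moves_append_left (s : List (I × ℤ)) {d d' : List (I × ℤ)}
    (h : ReflTransGen (Move A) d d') : ReflTransGen (Move A) (s ++ d) (s ++ d') := by
  simpa using moves_context s [] h

variable (hA : IsSimplyLacedCartan A)
include hA

lemma Move.wordProd_eq {d d' : List (I × ℤ)} (h : Move A d d') :
    wordProd A (d'.map Prod.fst) = wordProd A (d.map Prod.fst) := by
  cases h with
  | @braid s t i j a b c hij =>
    have := wordProd_append_congr (rfl : wordProd A (s.map Prod.fst) = _)
      (wordProd_append_congr (wordProd_braid hA hij).symm (rfl : wordProd A (t.map Prod.fst) = _))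
    simpa using this
  | @comm s t i j a b hij =>
    have := wordProd_append_congr (rfl : wordProd A (s.map Prod.fst) = _)
      (wordProd_append_congr (wordProd_comm hA hij).symm (rfl : wordProd A (t.map Prod.fst) = _))
    simpa using this

omit [Fintype I] [DecidableEq I] hA in
lemma Move.length_eq {d d' : List (I × ℤ)} (h : Move A d d') : d'.length = d.length := by
  cases h <;> simp

lemma moves_invariants {d d' : List (I × ℤ)} (h : ReflTransGen (Move A) d d') :
    wordProd A (d'.map Prod.fst) = wordProd A (d.map Prod.fst) ∧ d'.length = d.length := by
  induction h with
  | refl => exact ⟨rfl, rfl⟩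
  | tail _ h ih => exact ⟨(h.wordProd_eq hA).trans ih.1, h.length_eq.trans ih.2⟩

/-- Labelled form of the theorem of Iwahori, Matsumoto and Tits: the labels on a reduced word
can be transported to any other reduced word of the same element. -/
lemma exists_moves {l : List I} (d : List (I × ℤ)) (hd : IsReduced A (d.map Prod.fst))
    (hl : IsReduced A l) (h : wordProd A l = wordProd A (d.map Prod.fst)) :
    ∃ d', ReflTransGen (Move A) d d' ∧ d'.map Prod.fst = l := by
  obtain ⟨n, hn⟩ : ∃ n, d.length = n := ⟨_, rfl⟩
  induction n using Nat.strong_induction_on generalizing l d with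
  | _ n ih =>
    have hlen : l.length = d.length := by
      rw [IsReduced, h, hd] at hl
      simpa using hl.symm
    rcases List.eq_nil_or_concat d with rfl | ⟨d, ⟨i, a⟩, rfl⟩
    · refine ⟨[], .refl, ?_⟩
      rw [List.map_nil, eq_comm, ← List.length_eq_zero_iff, hlen, List.length_nil]
    rcases List.eq_nil_or_concat l with rfl | ⟨l, j, rfl⟩
    · simp at hlen
    simp only [List.concat_eq_append, List.length_append, List.length_singleton,
      List.map_append, List.map_cons, List.map_nil] at *
    -- Words with the same last letter are handled by induction.
    have same : ∀ {l : List I} {i : I} {a : ℤ} (d : List (I × ℤ)), d.length + 1 = n →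
        IsReduced A (d.map Prod.fst ++ [i]) → IsReduced A (l ++ [i]) →
        wordProd A (l ++ [i]) = wordProd A (d.map Prod.fst ++ [i]) →
        ∃ d', ReflTransGen (Move A) (d ++ [(i, a)]) (d' ++ [(i, a)]) ∧ d'.map Prod.fst = l := by
      intro l i a d hdn hd hl h
      obtain ⟨d', hd', e⟩ := ih d.length (by omega) d hd.left hl.left
        (wordProd_right_cancel hA h) rfl
      exact ⟨d', moves_append_right _ hd', e⟩
    by_cases hij : i = j
    · subst hij
      obtain ⟨d', hd', e⟩ := same (a := a) d hn hd hl h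
      exact ⟨_, hd', by simp [e]⟩
    have hdi := hd.isDescent hA
    have hdj := hl.isDescent hA
    have hdj : IsDescent A (d.map Prod.fst ++ [i]) j := by
      rw [isDescent_iff hA] at hdj ⊢
      rwa [← h]
    have hdlen : len A (wordProd A (d.map Prod.fst ++ [i])) = d.length + 1 := by
      rw [hd]
      simp
    rcases hA.offDiag i j hij with h0 | h1
    · obtain ⟨u, hu, hulen⟩ := exists_reduced_of_comm hA h0 hdi hdj
      have hu' : wordProd A (u ++ [j, i]) = wordProd A (d.map Prod.fst ++ [i]) := by
        rw [← hu]
        exact wordProd_append_congr rfl (wordProd_comm hA h0).symm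
      have hr : IsReduced A (u ++ [j, i]) := hd.of_eq hu' (by simp; omega)
      have hr' : IsReduced A (u ++ [i, j]) := hd.of_eq hu (by simp; omega)
      obtain ⟨d1, hd1, e1⟩ := same (l := u ++ [j]) (a := a) d hn hd (by simpa using hr)
        (by simpa using hu')
      obtain ⟨v, ⟨j', b⟩, rfl⟩ : ∃ v p, d1 = v ++ [p] := by
        rcases List.eq_nil_or_concat d1 with rfl | ⟨v, p, hv⟩
        · simp at e1
        · exact ⟨v, p, by simpa using hv⟩
      simp only [List.map_append, List.map_cons, List.map_nil] at e1
      obtain ⟨rfl, e1⟩ := List.append_inj' e1 rfl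
      obtain rfl : j' = j := by simpa using e1
      have hstep : Move A (v ++ [(j', b)] ++ [(i, a)]) (v ++ [(i, a)] ++ [(j', b)]) := by
        simpa using Move.comm v [] b a ((hA.symm _ _).trans h0)
      have hvlen : v.length + 1 = d.length := by simp at hulen; omega
      obtain ⟨d2, hd2, e2⟩ := same (l := l) (i := j') (a := b) (v ++ [(i, a)])
        (by simp; omega) (by simpa using hr') hl (by rw [h, ← hu]; simp)
      exact ⟨_, (hd1.tail hstep).trans hd2, by simp [e2]⟩
    · obtain ⟨u, hu, hulen⟩ := exists_reduced_of_braid hA h1 hdi hdj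
      have hu' : wordProd A (u ++ [i, j, i]) = wordProd A (d.map Prod.fst ++ [i]) := by
        rw [← hu]
        exact wordProd_append_congr rfl (wordProd_braid hA h1)
      have hr : IsReduced A (u ++ [i, j, i]) := hd.of_eq hu' (by simp; omega)
      have hr' : IsReduced A (u ++ [j, i, j]) := hd.of_eq hu (by simp; omega)
      obtain ⟨d1, hd1, e1⟩ := same (l := u ++ [i, j]) (a := a) d hn hd (by simpa using hr)
        (by simpa using hu')
      obtain ⟨v, w, rfl, rfl, hw⟩ := List.map_eq_append_iff.1 e1
      obtain ⟨b, c, rfl⟩ : ∃ b c, w = [(i, b), (j, c)] := by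
        match w, hw with
        | [(_, b), (_, c)], hw =>
          simp only [List.map_cons, List.map_nil, List.cons.injEq, and_true] at hw
          exact ⟨b, c, by rw [hw.1, hw.2]⟩
      have hstep : Move A (v ++ [(i, b), (j, c)] ++ [(i, a)])
          (v ++ [(j, c + a - min b a), (i, min b a)] ++ [(j, b + c - min b a)]) := by
        simpa using Move.braid v [] b c a h1
      obtain ⟨d2, hd2, e2⟩ := same (l := l) (i := j) (a := b + c - min b a)
        (v ++ [(j, c + a - min b a), (i, min b a)])
        (by simp at hulen ⊢; omega) (by simpa using hr') hl (by rw [h, ← hu]; simp)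
      exact ⟨_, (hd1.tail hstep).trans hd2, by simp [e2]⟩

/-- Bound on the `k`-th label, given bounds on the first label in the whole class. -/
lemma label_le {d₀ : List (I × ℤ)} {n : ℤ} (hred : IsReduced A (d₀.map Prod.fst))
    (hmax : ∀ j, IsDescent A (d₀.map Prod.fst) j)
    (hnonneg : ∀ d, ReflTransGen (Move A) d₀ d → ∀ p ∈ d, 0 ≤ p.2)
    (hfirst : ∀ p d, ReflTransGen (Move A) d₀ (p :: d) → p.2 ≤ n)
    (s t : List (I × ℤ)) (p : I × ℤ) (h : ReflTransGen (Move A) d₀ (s ++ p :: t)) :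
    p.2 ≤ 2 ^ s.length * n := by
  obtain ⟨k, hk⟩ : ∃ k, s.length = k := ⟨_, rfl⟩
  induction k using Nat.strong_induction_on generalizing s t p with
  | _ k ih =>
    rcases List.eq_nil_or_concat s with rfl | ⟨s, ⟨i, a⟩, rfl⟩
    · simpa using hfirst p t h
    obtain ⟨j, b⟩ := p
    simp only [List.concat_eq_append, List.length_append, List.length_singleton,
      List.append_assoc, List.singleton_append] at *
    have hn : 0 ≤ n := by
      have h1 : ∀ d, ReflTransGen (Move A) d₀ d → d ≠ [] → 0 ≤ n := by
        rintro (_ | ⟨q, d⟩) hd hne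
        · exact absurd rfl hne
        · exact (hnonneg _ hd q (by simp)).trans (hfirst q d hd)
      exact h1 _ h (by simp)
    have hpow : (2 : ℤ) ^ (s.length + 1) * n = 2 * (2 ^ s.length * n) := by ring
    have hN : 0 ≤ 2 ^ s.length * n := by positivity
    rw [hpow]
    suffices b ≤ 2 * (2 ^ s.length * n) from this
    obtain ⟨hprod, hlen⟩ := moves_invariants hA h
    have hred' : IsReduced A ((s ++ (i, a) :: (j, b) :: t).map Prod.fst) :=
      hred.of_eq hprod (by simpa using hlen)
    have hmax' : ∀ m, IsDescent A ((s ++ (i, a) :: (j, b) :: t).map Prod.fst) m := by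
      intro m
      rw [isDescent_iff hA, hprod, ← isDescent_iff hA]
      exact hmax m
    simp only [List.map_append, List.map_cons] at hred' hmax'
    have hredw : IsReduced A (s.map Prod.fst ++ [i, j]) := by
      have : IsReduced A (s.map Prod.fst ++ [i, j] ++ t.map Prod.fst) := by simpa using hred'
      exact this.left
    have hb : 0 ≤ b := hnonneg _ h (j, b) (by simp)
    have hij : i ≠ j := by
      rintro rfl
      have h1 : IsReduced A (s.map Prod.fst ++ [i] ++ [i]) := by simpa using hredw
      exact h1.not_isDescent (h1.left.isDescent hA)
    rcases hA.offDiag i j hij with h0 | h1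
    · have := ih s.length (by omega) s ((i, a) :: t) (j, b) (h.tail (Move.comm s t a b h0)) rfl
      dsimp only at this
      omega
    by_cases hi : IsDescent A (s.map Prod.fst ++ [i, j]) i
    · have hj : IsDescent A (s.map Prod.fst ++ [i, j]) j := by
        have h2 : IsReduced A (s.map Prod.fst ++ [i] ++ [j]) := by simpa using hredw
        simpa using h2.isDescent hA
      obtain ⟨u, hu, hulen⟩ := exists_reduced_of_braid hA h1 hi hj
      rw [hredw] at hulen
      have hru : IsReduced A (u ++ [j, i] ++ [j]) :=
        hredw.of_eq (by simpa using hu) (by simp at hulen ⊢; omega)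
      obtain ⟨d1, hd1, e1⟩ := exists_moves hA (l := u ++ [j, i]) (s ++ [(i, a)])
        (by
          have : IsReduced A (s.map Prod.fst ++ [i] ++ [j]) := by simpa using hredw
          simpa using this.left)
        hru.left (wordProd_right_cancel hA (i := j) (by simpa using hu))
      obtain ⟨v, w, rfl, rfl, hw⟩ := List.map_eq_append_iff.1 e1
      obtain ⟨x, y, rfl⟩ : ∃ x y, w = [(j, x), (i, y)] := by
        match w, hw with
        | [(_, b), (_, c)], hw =>
          simp only [List.map_cons, List.map_nil, List.cons.injEq, and_true] at hw
          exact ⟨b, c, by rw [hw.1, hw.2]⟩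
      have hvlen : v.length + 1 = s.length := by simp at hulen; omega
      have h2 : ReflTransGen (Move A) d₀ (v ++ (j, x) :: (i, y) :: (j, b) :: t) := by
        have := h.trans (by simpa using moves_append_right ((j, b) :: t) hd1)
        simpa using this
      have h3 := h2.tail (Move.braid v t x y b ((hA.symm _ _).trans h1))
      have hx := ih v.length (by omega) v _ _ h2 rfl
      have hz := ih v.length (by omega) v _ _ h3 rfl
      have hy : 0 ≤ y := hnonneg _ h2 (i, y) (by simp)
      rw [← hvlen, pow_succ]
      dsimp only at hx hz
      have hN' : 0 ≤ 2 ^ v.length * n := by positivity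
      have hmin := min_le_left x b
      nlinarith
    · obtain ⟨m, hm, hmlen⟩ := exists_reduced_cons hA (l := s.map Prod.fst ++ [i, j])
        (m := t.map Prod.fst) (by simpa using hred') (by simpa using hmax') hi
      have hrt : IsReduced A (t.map Prod.fst) := by
        have : IsReduced A (s.map Prod.fst ++ [i, j] ++ t.map Prod.fst) := by simpa using hred'
        exact this.right hA
      obtain ⟨t', ht', e⟩ := exists_moves hA (l := i :: m) t hrt
        (hrt.of_eq hm (by simpa using hmlen)) hm
      obtain ⟨⟨i', c⟩, t', rfl, rfl, rfl⟩ := List.map_eq_cons_iff.1 e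
      have h2 : ReflTransGen (Move A) d₀ (s ++ (i', a) :: (j, b) :: (i', c) :: t') := by
        have := h.trans (by simpa using moves_append_left (s ++ [(i', a), (j, b)]) ht')
        simpa using this
      have h3 := h2.tail (Move.braid s t' a b c h1)
      have hz := ih s.length (by omega) s _ _ h3 rfl
      dsimp only at hz
      have hmin := min_le_right a c
      omega

end Moves

section Transfer

variable {A : Matrix I I ℤ} {w₀ : Function.End (I → ℤ)} {ν : ℕ}

/-- The labelled word attached to a pair of sequences. -/
def labelledWord {ν : ℕ} (p : (Fin ν → I) × (Fin ν → ℤ)) : List (I × ℤ) :=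
  List.ofFn fun k => (p.1 k, p.2 k)

omit [Fintype I] [DecidableEq I] in
lemma labelledWord_surjective (d : List (I × ℤ)) (h : d.length = ν) :
    ∃ p : (Fin ν → I) × (Fin ν → ℤ), labelledWord p = d := by
  subst h
  exact ⟨(fun k => (d.get k).1, fun k => (d.get k).2), List.ofFn_get d⟩

omit [Fintype I] [DecidableEq I] in
lemma map_fst_labelledWord (p : (Fin ν → I) × (Fin ν → ℤ)) :
    (labelledWord p).map Prod.fst = List.ofFn p.1 := by
  simp [labelledWord, List.map_ofFn, Function.comp_def]

omit [Fintype I] [DecidableEq I] in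
lemma length_labelledWord (p : (Fin ν → I) × (Fin ν → ℤ)) : (labelledWord p).length = ν := by
  simp [labelledWord]

omit [Fintype I] [DecidableEq I] in
lemma eq_getElem_of_labelledWord_eq {p : (Fin ν → I) × (Fin ν → ℤ)} {d : List (I × ℤ)}
    (h : labelledWord p = d) (k : Fin ν) :
    some (p.1 k, p.2 k) = d[(k : ℕ)]? := by
  subst h
  simp [labelledWord]

lemma tAdjacent_of_move {p q : (Fin ν → I) × (Fin ν → ℤ)} (hp : p.1 ∈ RedWord A w₀ ν)
    (hq : q.1 ∈ RedWord A w₀ ν) (h : Move A (labelledWord p) (labelledWord q)) :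
    TAdjacent A w₀ ν p q := by
  refine ⟨hp, hq, ?_⟩
  generalize hd : labelledWord p = d at h
  generalize hd' : labelledWord q = d' at h
  have hlen := congrArg List.length hd
  rw [length_labelledWord] at hlen
  have ep := eq_getElem_of_labelledWord_eq hd
  have eq := eq_getElem_of_labelledWord_eq hd'
  cases h with
  | @braid s t i j a b c hij =>
    simp only [List.length_append, List.length_cons] at hlen
    have p0 := ep ⟨s.length, by omega⟩
    have p1 := ep ⟨s.length + 1, by omega⟩
    have p2 := ep ⟨s.length + 2, by omega⟩
    have q0 := eq ⟨s.length, by omega⟩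
    have q1 := eq ⟨s.length + 1, by omega⟩
    have q2 := eq ⟨s.length + 2, by omega⟩
    simp at p0 p1 p2 q0 q1 q2
    refine Or.inl ⟨s.length, by omega, by omega, by omega, ?_⟩
    refine ⟨by simp [p0, p1, hij], by simp [p0, p2], by simp [q0, p1], by simp [q1, p0],
      by simp [q2, p1], ?_, by simp [q0, p0, p1, p2], by simp [q1, p0, p2],
      by simp [q2, p0, p1, p2]⟩
    intro k h0 h1 h2
    have hk : some (q.1 k, q.2 k) = some (p.1 k, p.2 k) := by
      rw [ep, eq]
      rcases lt_or_ge (k : ℕ) s.length with hlt | hge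
      · rw [List.getElem?_append_left hlt, List.getElem?_append_left hlt]
      · obtain ⟨m, hm⟩ : ∃ m, (k : ℕ) = s.length + (m + 3) := ⟨k - s.length - 3, by omega⟩
        rw [hm, List.getElem?_append_right (by omega), List.getElem?_append_right (by omega)]
        simp
    simpa using hk
  | @comm s t i j a b hij =>
    simp only [List.length_append, List.length_cons] at hlen
    have p0 := ep ⟨s.length, by omega⟩
    have p1 := ep ⟨s.length + 1, by omega⟩
    have q0 := eq ⟨s.length, by omega⟩
    have q1 := eq ⟨s.length + 1, by omega⟩
    simp at p0 p1 q0 q1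
    refine Or.inr ⟨s.length, by omega, by omega, ?_⟩
    refine ⟨by simp [p0, p1, hij], by simp [q0, p1], by simp [q1, p0], ?_,
      by simp [q0, p1], by simp [q1, p0]⟩
    intro k h0 h1
    have hk : some (q.1 k, q.2 k) = some (p.1 k, p.2 k) := by
      rw [ep, eq]
      rcases lt_or_ge (k : ℕ) s.length with hlt | hge
      · rw [List.getElem?_append_left hlt, List.getElem?_append_left hlt]
      · obtain ⟨m, hm⟩ : ∃ m, (k : ℕ) = s.length + (m + 2) := ⟨k - s.length - 2, by omega⟩
        rw [hm, List.getElem?_append_right (by omega), List.getElem?_append_right (by omega)]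
        simp
    simpa using hk

lemma exists_eqvGen_of_moves (hA : IsSimplyLacedCartan A) {p : (Fin ν → I) × (Fin ν → ℤ)}
    (hp : p.1 ∈ RedWord A w₀ ν) {d : List (I × ℤ)}
    (h : Relation.ReflTransGen (Move A) (labelledWord p) d) :
    ∃ q, q.1 ∈ RedWord A w₀ ν ∧ labelledWord q = d ∧
      Relation.EqvGen (TAdjacent A w₀ ν) p q := by
  induction h with
  | refl => exact ⟨p, hp, rfl, .refl p⟩
  | @tail d d' _ h ih =>
    obtain ⟨q, hq, rfl, hpq⟩ := ih
    obtain ⟨r, rfl⟩ := labelledWord_surjective d' (h.length_eq.trans (length_labelledWord q))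
    have hr : r.1 ∈ RedWord A w₀ ν := by
      have := h.wordProd_eq hA
      rw [map_fst_labelledWord, map_fst_labelledWord] at this
      exact Eq.trans this hq
    exact ⟨r, hr, rfl, hpq.trans _ _ _ (.rel _ _ (tAdjacent_of_move hq hr h))⟩

lemma label_bound (hA : IsSimplyLacedCartan A) (hw : IsLongest A w₀ ν) {n : ℕ}
    {p : (Fin ν → I) × (Fin ν → ℤ)} (hp : p.1 ∈ RedWord A w₀ ν)
    (h : ∀ q, Relation.EqvGen (TAdjacent A w₀ ν) p q →
      (∀ k : Fin ν, 0 ≤ q.2 k) ∧ (∀ k : Fin ν, (k : ℕ) = 0 → q.2 k ≤ n)) (k : Fin ν) :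
    p.2 k ≤ 2 ^ (k : ℕ) * n := by
  have hprod : wordProd A ((labelledWord p).map Prod.fst) = w₀ := by
    rw [map_fst_labelledWord]
    exact hp
  have hred : IsReduced A ((labelledWord p).map Prod.fst) := by
    rw [IsReduced, hprod, hw.len_eq, List.length_map, length_labelledWord]
  have hmax : ∀ j, IsDescent A ((labelledWord p).map Prod.fst) j := by
    intro j
    by_contra hj
    have h1 : IsDescent A ((labelledWord p).map Prod.fst ++ [j]) j := by
      rw [isDescent_iff hA, wordProd_append, wordProd_cons, wordProd_nil, sE_single_self hA,
        wordProd_neg]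
      simpa using wordProd_single_nonneg hA hj
    have h2 := h1.len_add_one hA
    rw [wordProd_append_twice hA, hprod, hw.len_eq] at h2
    have h3 := hw.longest (wordProd A ((labelledWord p).map Prod.fst ++ [j])) ⟨_, rfl⟩
    omega
  have hk : (k : ℕ) < (labelledWord p).length := by rw [length_labelledWord]; exact k.2
  have hsplit : labelledWord p = (labelledWord p).take k ++
      (p.1 k, p.2 k) :: (labelledWord p).drop (k + 1) := by
    conv_lhs => rw [← List.take_append_drop k (labelledWord p), List.drop_eq_getElem_cons hk]
    simp [labelledWord]
  have := label_le hA (n := n) hred hmax ?_ ?_ _ _ (p.1 k, p.2 k)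
    (by rw [← hsplit])
  · rwa [List.length_take_of_le hk.le] at this
  · intro d hd x hx
    obtain ⟨q, -, rfl, hpq⟩ := exists_eqvGen_of_moves hA hp hd
    obtain ⟨m, rfl⟩ := (List.mem_ofFn' _ _).1 hx
    exact (h q hpq).1 m
  · intro x d hd
    obtain ⟨q, -, e, hpq⟩ := exists_eqvGen_of_moves hA hp hd
    have hν : 0 < ν := by
      rw [← length_labelledWord q, e]
      simp
    have h0 := eq_getElem_of_labelledWord_eq e ⟨0, hν⟩
    simp only [List.getElem?_cons_zero, Option.some.injEq] at h0
    rw [← h0]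
    exact (h q hpq).2 ⟨0, hν⟩ rfl

end Transfer

/-- Proposition A.3: `𝒰_ℕ^n` is finite, i.e. the collection of
equivalence classes all of whose representatives have nonnegative entries with
first entry `≤ n` is finite. -/
theorem UNn_finite (A : Matrix I I ℤ) (hA : IsSimplyLacedCartan A)
    (w₀ : Function.End (I → ℤ)) (ν : ℕ) (hw : IsLongest A w₀ ν) (n : ℕ) :
    {C : Set ((Fin ν → I) × (Fin ν → ℤ)) |
      ∃ p, p.1 ∈ RedWord A w₀ ν ∧
        (∀ q, Relation.EqvGen (TAdjacent A w₀ ν) p q →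
          (∀ k : Fin ν, 0 ≤ q.2 k) ∧
          (∀ k : Fin ν, (k : ℕ) = 0 → q.2 k ≤ n)) ∧
        C = {q | Relation.EqvGen (TAdjacent A w₀ ν) p q}}.Finite := by
  refine ((Set.finite_univ.prod (Set.finite_Icc (0 : Fin ν → ℤ) fun k => 2 ^ (k : ℕ) * n)).image
    fun p : (Fin ν → I) × (Fin ν → ℤ) => {q | Relation.EqvGen (TAdjacent A w₀ ν) p q}).subset ?_
  rintro C ⟨p, hp, h, rfl⟩
  exact ⟨p, ⟨Set.mem_univ _, fun k => (h p (.refl p)).1 k, label_bound hA hw hp h⟩, rfl⟩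

end Lusztig
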